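/- Let f : ℝⁿ → ℝ be a convex function, x̄ ∈ ℝⁿ, and s̄ ∈ ∂f(x̄). Then ∂f is metrically subregular at x̄ for s̄ — i.e., there exist κ > 0, ε > 0 and δ > 0 such that for every x with ‖x − x̄‖ < ε and every g ∈ ∂f(x) with ‖g − s̄‖ < δ one has dist(x, (∂f)⁻¹(s̄)) ≤ κ‖g − s̄‖ — if and only if the quadratic growth condition holds at x̄ for s̄: there exist κ' > 0 and ε' > 0 such that for all x with ‖x − x̄‖ < ε', f(x) ≥ f(x̄) + ⟨s̄, x − x̄⟩ + κ' · dist(x, (∂f)⁻¹(s̄))², where (∂f)⁻¹(s̄) = {y : s̄ ∈ ∂f(y)}. -/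

import Mathlib

open Matrix

/-- Euclidean norm on `Fin n → ℝ`. -/
noncomputable def euclNorm {n : ℕ} (x : Fin n → ℝ) : ℝ := Real.sqrt (∑ i, x i ^ 2)

/-- Euclidean inner product on `Fin n → ℝ`. -/
def dotp {n : ℕ} (x y : Fin n → ℝ) : ℝ := ∑ i, x i * y i

/-- ℓ₁ norm on `Fin n → ℝ`. -/
def l1norm {n : ℕ} (x : Fin n → ℝ) : ℝ := ∑ i, |x i|

/-- Euclidean distance from a point to a set: `inf_{y ∈ S} ‖x − y‖`. -/
noncomputable def distSet {n : ℕ} (x : Fin n → ℝ) (S : Set (Fin n → ℝ)) : ℝ :=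
  sInf ((fun y => euclNorm (x - y)) '' S)

/-- Subdifferential of a (convex) function `g` at `x`. -/
def subdiff {n : ℕ} (g : (Fin n → ℝ) → ℝ) (x : Fin n → ℝ) : Set (Fin n → ℝ) :=
  {s : Fin n → ℝ | ∀ y, g y ≥ g x + dotp s (y - x)}

lemma euclNorm_eq_norm_toLp {n : ℕ} (x : Fin n → ℝ) : euclNorm x = ‖WithLp.toLp 2 x‖ := by
  simp [euclNorm, EuclideanSpace.norm_eq]

lemma euclNorm_nonneg {n : ℕ} (x : Fin n → ℝ) : 0 ≤ euclNorm x := Real.sqrt_nonneg _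

lemma euclNorm_sq {n : ℕ} (x : Fin n → ℝ) : euclNorm x ^ 2 = ∑ i, x i ^ 2 :=
  Real.sq_sqrt (Finset.sum_nonneg fun _ _ => sq_nonneg _)

lemma euclNorm_add_le {n : ℕ} (x y : Fin n → ℝ) : euclNorm (x + y) ≤ euclNorm x + euclNorm y := by
  simp only [euclNorm_eq_norm_toLp, WithLp.toLp_add]
  exact norm_add_le _ _

lemma euclNorm_sub_comm {n : ℕ} (x y : Fin n → ℝ) : euclNorm (x - y) = euclNorm (y - x) := by
  simp only [euclNorm_eq_norm_toLp, WithLp.toLp_sub]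
  exact norm_sub_rev _ _

lemma dotp_le_euclNorm_mul {n : ℕ} (x y : Fin n → ℝ) : dotp x y ≤ euclNorm x * euclNorm y :=
  Real.sum_mul_le_sqrt_mul_sqrt _ _ _

lemma dotp_add_right {n : ℕ} (x y z : Fin n → ℝ) : dotp x (y + z) = dotp x y + dotp x z := by
  simp [dotp, mul_add, Finset.sum_add_distrib]

lemma dotp_sub_right {n : ℕ} (x y z : Fin n → ℝ) : dotp x (y - z) = dotp x y - dotp x z := by
  simp [dotp, mul_sub, Finset.sum_sub_distrib]

lemma dotp_sub_left {n : ℕ} (x y z : Fin n → ℝ) : dotp (x - y) z = dotp x z - dotp y z := by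
  simp [dotp, sub_mul, Finset.sum_sub_distrib]

lemma dotp_add_left {n : ℕ} (x y z : Fin n → ℝ) : dotp (x + y) z = dotp x z + dotp y z := by
  simp [dotp, add_mul, Finset.sum_add_distrib]

lemma dotp_smul_right {n : ℕ} (c : ℝ) (x y : Fin n → ℝ) : dotp x (c • y) = c * dotp x y := by
  simp [dotp, Finset.mul_sum, mul_left_comm]

lemma euclNorm_add_smul_sq {n : ℕ} (c : ℝ) (x y : Fin n → ℝ) :
    euclNorm (x + c • y) ^ 2 = euclNorm x ^ 2 + 2 * c * dotp x y + c ^ 2 * euclNorm y ^ 2 := by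
  simp only [euclNorm_sq, dotp, Finset.mul_sum, ← Finset.sum_add_distrib]
  exact Finset.sum_congr rfl fun i _ => by simp; ring

lemma distSet_nonneg {n : ℕ} (x : Fin n → ℝ) (S : Set (Fin n → ℝ)) : 0 ≤ distSet x S :=
  Real.sInf_nonneg (by rintro _ ⟨y, -, rfl⟩; exact euclNorm_nonneg _)

lemma distSet_le {n : ℕ} {x y : Fin n → ℝ} {S : Set (Fin n → ℝ)} (hy : y ∈ S) :
    distSet x S ≤ euclNorm (x - y) :=
  csInf_le ⟨0, by rintro _ ⟨z, -, rfl⟩; exact euclNorm_nonneg _⟩ ⟨y, hy, rfl⟩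

lemma le_distSet {n : ℕ} {x : Fin n → ℝ} {S : Set (Fin n → ℝ)} (hS : S.Nonempty) {r : ℝ}
    (h : ∀ y ∈ S, r ≤ euclNorm (x - y)) : r ≤ distSet x S :=
  le_csInf (hS.image _) (by rintro _ ⟨y, hy, rfl⟩; exact h y hy)

lemma distSet_le_add {n : ℕ} (x y : Fin n → ℝ) {S : Set (Fin n → ℝ)} (hS : S.Nonempty) :
    distSet x S ≤ euclNorm (x - y) + distSet y S := by
  rw [← sub_le_iff_le_add']
  refine le_distSet hS fun z hz => ?_
  have h := euclNorm_add_le (x - y) (y - z)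
  rw [sub_add_sub_cancel] at h
  linarith [distSet_le (x := x) hz]

lemma continuous_euclNorm {n : ℕ} : Continuous (euclNorm : (Fin n → ℝ) → ℝ) := by
  unfold euclNorm
  fun_prop

lemma isCompact_euclNorm_sub_le {n : ℕ} (x : Fin n → ℝ) (r : ℝ) :
    IsCompact {z | euclNorm (z - x) ≤ r} := by
  have h := (isCompact_closedBall (WithLp.toLp 2 x) r).image
    (PiLp.continuous_ofLp 2 fun _ : Fin n => ℝ)
  convert h using 1
  ext z
  constructor
  · intro hz
    refine ⟨WithLp.toLp 2 z, ?_, rfl⟩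
    rw [Metric.mem_closedBall, dist_eq_norm, ← WithLp.toLp_sub, ← euclNorm_eq_norm_toLp]
    exact hz
  · rintro ⟨w, hw, rfl⟩
    rw [Metric.mem_closedBall, dist_eq_norm] at hw
    simpa [euclNorm_eq_norm_toLp] using hw

/-- The proximal objective `z ↦ f z - ⟨s, z⟩ + ½ ‖z - x‖²` has a minimizer if `s` is a
subgradient of `f` at some point. -/
lemma exists_prox {n : ℕ} {f : (Fin n → ℝ) → ℝ} (hf : Continuous f) {a s : Fin n → ℝ}
    (hs : s ∈ subdiff f a) (x : Fin n → ℝ) :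
    ∃ y, ∀ z, f y - dotp s y + euclNorm (y - x) ^ 2 / 2 ≤
      f z - dotp s z + euclNorm (z - x) ^ 2 / 2 := by
  have hcont : Continuous fun z => f z - dotp s z + euclNorm (z - x) ^ 2 / 2 := by
    have h1 : Continuous fun z => dotp s z := by unfold dotp; fun_prop
    have h2 : Continuous fun z => euclNorm (z - x) := continuous_euclNorm.comp (by fun_prop)
    fun_prop
  have ha : a ∈ {z | euclNorm (z - x) ≤ euclNorm (a - x)} := le_refl (euclNorm (a - x))
  obtain ⟨y, -, hy⟩ := (isCompact_euclNorm_sub_le x (euclNorm (a - x))).exists_isMinOn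
    ⟨a, ha⟩ hcont.continuousOn
  refine ⟨y, fun z => ?_⟩
  by_cases hz : euclNorm (z - x) ≤ euclNorm (a - x)
  · exact hy hz
  · have h1 : f y - dotp s y + euclNorm (y - x) ^ 2 / 2 ≤
      f a - dotp s a + euclNorm (a - x) ^ 2 / 2 := hy ha
    have h2 := hs z
    rw [dotp_sub_right] at h2
    have h3 := pow_le_pow_left₀ (euclNorm_nonneg _) (not_le.mp hz).le 2
    linarith

/-- First-order optimality condition for the proximal objective. -/
lemma add_sub_mem_subdiff_of_prox {n : ℕ} {f : (Fin n → ℝ) → ℝ} (hf : ConvexOn ℝ Set.univ f)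
    {s x y : Fin n → ℝ} (hy : ∀ z, f y - dotp s y + euclNorm (y - x) ^ 2 / 2 ≤
      f z - dotp s z + euclNorm (z - x) ^ 2 / 2) :
    s + (x - y) ∈ subdiff f y := by
  intro z
  have key : ∀ t ∈ Set.Ioo (0 : ℝ) 1,
      f y + dotp (s + (x - y)) (z - y) ≤ f z + t * (euclNorm (z - y) ^ 2 / 2) := by
    rintro t ⟨ht0, ht1⟩
    have h1 := hy (y + t • (z - y))
    have h2 : f (y + t • (z - y)) ≤ (1 - t) * f y + t * f z := by
      have := hf.2 (Set.mem_univ y) (Set.mem_univ z) (sub_nonneg.2 ht1.le) ht0.le (by ring)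
      simp only [smul_eq_mul] at this
      rwa [show (1 - t) • y + t • z = y + t • (z - y) by module] at this
    rw [add_sub_right_comm, euclNorm_add_smul_sq, dotp_add_right, dotp_smul_right] at h1
    have h3 : dotp (s + (x - y)) (z - y) = dotp s (z - y) - dotp (y - x) (z - y) := by
      simp only [dotp_add_left, dotp_sub_left]; ring
    rw [h3]
    refine le_of_mul_le_mul_left ?_ ht0
    nlinarith
  have hlim : Filter.Tendsto (fun t : ℝ => f z + t * (euclNorm (z - y) ^ 2 / 2))
      (nhdsWithin 0 (Set.Ioi 0)) (nhds (f z)) := by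
    have : Continuous fun t : ℝ => f z + t * (euclNorm (z - y) ^ 2 / 2) := by fun_prop
    simpa using (this.tendsto 0).mono_left nhdsWithin_le_nhds
  exact ge_of_tendsto hlim
    (Filter.eventually_of_mem (Ioo_mem_nhdsGT one_pos) key)

/-- **Metric subregularity ⇔ quadratic growth for convex functions** (Proposition 1):
for a convex `f : ℝⁿ → ℝ`, `x̄` and `s̄ ∈ ∂f(x̄)`, the subdifferential `∂f` is
metrically subregular at `x̄` for `s̄` if and only if the quadratic growth condition
`f(x) ≥ f(x̄) + ⟨s̄, x − x̄⟩ + κ'·dist(x, (∂f)⁻¹(s̄))²` holds near `x̄`. -/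
theorem subdiff_metric_subregular_iff_quadratic_growth
    {n : ℕ} (f : (Fin n → ℝ) → ℝ)
    (hconv : ConvexOn ℝ Set.univ f)
    (xbar : Fin n → ℝ) (sbar : Fin n → ℝ) (hsbar : sbar ∈ subdiff f xbar) :
    (∃ κ > 0, ∃ ε > 0, ∃ δ > 0, ∀ x : Fin n → ℝ, euclNorm (x - xbar) < ε →
        ∀ g ∈ subdiff f x, euclNorm (g - sbar) < δ →
          distSet x {y | sbar ∈ subdiff f y} ≤ κ * euclNorm (g - sbar)) ↔
      (∃ κ' > 0, ∃ ε' > 0, ∀ x : Fin n → ℝ, euclNorm (x - xbar) < ε' →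
        f x ≥ f xbar + dotp sbar (x - xbar)
          + κ' * distSet x {y | sbar ∈ subdiff f y} ^ 2) := by
  have hne : {y | sbar ∈ subdiff f y}.Nonempty := ⟨xbar, hsbar⟩
  have hcont : Continuous f := by
    simpa [continuousOn_univ] using hconv.continuousOn isOpen_univ
  constructor
  · rintro ⟨κ, hκ, ε, hε, δ, hδ, h⟩
    refine ⟨1 / (2 * (1 + κ) ^ 2), by positivity, min (ε / 2) δ, by positivity, fun x hx => ?_⟩
    obtain ⟨y, hy⟩ := exists_prox hcont hsbar x
    have hbar := hy xbar
    have hmin := hsbar y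
    rw [dotp_sub_right] at hmin
    have hyx : euclNorm (y - x) ≤ euclNorm (x - xbar) := by
      rw [euclNorm_sub_comm x xbar]
      refine (pow_le_pow_iff_left₀ (euclNorm_nonneg _) (euclNorm_nonneg _) two_ne_zero).1 ?_
      linarith
    have hyb : euclNorm (y - xbar) < ε := by
      have := euclNorm_add_le (y - x) (x - xbar)
      rw [sub_add_sub_cancel] at this
      linarith [hx.trans_le (min_le_left _ _)]
    have hsub := h y hyb _ (add_sub_mem_subdiff_of_prox hconv hy)
    rw [add_sub_cancel_left, euclNorm_sub_comm x y] at hsub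
    have hdy := hsub (hyx.trans_lt (hx.trans_le (min_le_right _ _)))
    have hdx := distSet_le_add x y hne
    rw [euclNorm_sub_comm x y] at hdx
    have hd : distSet x {y | sbar ∈ subdiff f y} ≤ (1 + κ) * euclNorm (y - x) := by linarith
    have hsq := pow_le_pow_left₀ (distSet_nonneg _ _) hd 2
    have hx' := hy x
    have h0 : euclNorm (x - x) ^ 2 = 0 := by simp [euclNorm_sq]
    have hfin : 1 / (2 * (1 + κ) ^ 2) * distSet x {y | sbar ∈ subdiff f y} ^ 2 ≤
        euclNorm (y - x) ^ 2 / 2 := by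
      rw [div_mul_eq_mul_div, div_le_div_iff₀ (by positivity) two_pos]
      linarith
    rw [dotp_sub_right]
    linarith
  · rintro ⟨κ, hκ, ε, hε, h⟩
    refine ⟨1 / κ, by positivity, ε, hε, 1, one_pos, fun x hx g hg _ => ?_⟩
    have hgrow := h x hx
    set d := distSet x {y | sbar ∈ subdiff f y} with hd
    have hd0 : 0 ≤ d := distSet_nonneg _ _
    have hgap : ∀ y ∈ {y | sbar ∈ subdiff f y},
        κ * d ^ 2 ≤ euclNorm (g - sbar) * euclNorm (x - y) := by
      intro y hy
      have h1 := hg y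
      have h2 := hy xbar
      have h3 := dotp_le_euclNorm_mul (g - sbar) (x - y)
      simp only [dotp_sub_right, dotp_sub_left] at *
      linarith
    have hv := euclNorm_nonneg (g - sbar)
    have hkd : κ * d ≤ euclNorm (g - sbar) := by
      rcases hd0.eq_or_lt with h0 | hdpos
      · rw [← h0, mul_zero]; exact hv
      rcases hv.eq_or_lt with h0 | hvpos
      · have := hgap xbar hsbar
        rw [← h0, zero_mul] at this
        exact absurd this (not_le.2 (by positivity))
      have : κ * d ^ 2 / euclNorm (g - sbar) ≤ d :=
        le_distSet hne fun y hy => (div_le_iff₀' hvpos).2 (hgap y hy)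
      rw [div_le_iff₀ hvpos] at this
      nlinarith
    rw [one_div_mul_eq_div, le_div_iff₀ hκ]
    linarith
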